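/- arXiv:2405.16784 — 2 statements merged into one kernel-verified Lean document; each statement's English description precedes it below -/
import Mathlib

section
/- Let F = GF(3^n) and Inv(x) = x^(3^n - 2). For a, b ∈ F with ab ≠ 0: the number of x ∈ F with Inv(x+a+b) - Inv(x+a) - Inv(x+b) + Inv(x) = 0 equals 3 if a^2 = b^2, and equals 1 if a^2 ≠ b^2. -/
theorem FiniteField.pow_card_sub_two_eq_inv {F : Type*} [Field F] [Fintype F]
    (h : 2 < Fintype.card F) (x : F) : x ^ (Fintype.card F - 2) = x⁻¹ := by
  rcases eq_or_ne x 0 with rfl | hx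
  · rw [inv_zero, zero_pow (by omega)]
  · apply eq_inv_of_mul_eq_one_left
    rw [← pow_succ, show Fintype.card F - 2 + 1 = Fintype.card F - 1 by omega,
      FiniteField.pow_card_sub_one_eq_one x hx]

/-- The vanishing of a second difference of inversion in characteristic three, in coordinates
symmetric about the midpoint: for directions `a` and `b`, `s = a + b` and `d = a - b`. -/
theorem inv_sub_add_inv_add_eq_iff {F : Type*} [Field F] (h3 : (3 : F) = 0) {s d : F}
    (hsd : s ^ 2 ≠ d ^ 2) (y : F) :
    (y - s)⁻¹ + (y + s)⁻¹ = (y - d)⁻¹ + (y + d)⁻¹ ↔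
      y = 0 ∨ (y ^ 2 = s ^ 2 ∧ d = 0) ∨ (y ^ 2 = d ^ 2 ∧ s = 0) := by
  have h2 : (2 : F) ≠ 0 := fun h => one_ne_zero (α := F) (by linear_combination h3 - h)
  have boundary : ∀ {t e : F}, t ^ 2 ≠ e ^ 2 → y ^ 2 = t ^ 2 → y ≠ 0 →
      ((y - t)⁻¹ + (y + t)⁻¹ = (y - e)⁻¹ + (y + e)⁻¹ ↔ e = 0) := by
    intro t e hte hy hy0
    have hsum : (y - t)⁻¹ + (y + t)⁻¹ = (2 * y)⁻¹ := by
      rcases sq_eq_sq_iff_eq_or_eq_neg.mp hy with h | h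
      · rw [← h, sub_self, inv_zero, zero_add, two_mul]
      · rw [show t = -y by rw [h, neg_neg], sub_neg_eq_add, add_neg_cancel, inv_zero, add_zero,
          two_mul]
    have h1 : y - e ≠ 0 := fun h => hte (by linear_combination (y + e) * h - hy)
    have h1' : y + e ≠ 0 := fun h => hte (by linear_combination (y - e) * h - hy)
    rw [hsum]
    constructor
    · intro h
      field_simp at h
      refine pow_eq_zero_iff (two_ne_zero) |>.mp ?_
      linear_combination -h - y ^ 2 * h3
    · rintro rfl
      field_simp
      simp only [sub_zero, add_zero]
      field_simp
      linear_combination -h3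
  rcases eq_or_ne y 0 with rfl | hy0
  · simp [inv_neg]
  by_cases hys : y ^ 2 = s ^ 2
  · simp [boundary hsd hys hy0, hy0, hys, hsd]
  by_cases hyd : y ^ 2 = d ^ 2
  · rw [eq_comm, boundary hsd.symm hyd hy0]
    simp [hy0, hyd, hsd.symm]
  have h1 : y - s ≠ 0 := fun h => hys (by linear_combination (y + s) * h)
  have h2' : y + s ≠ 0 := fun h => hys (by linear_combination (y - s) * h)
  have h3' : y - d ≠ 0 := fun h => hyd (by linear_combination (y + d) * h)
  have h4 : y + d ≠ 0 := fun h => hyd (by linear_combination (y - d) * h)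
  simp only [hy0, hys, hyd, false_and, or_self, iff_false]
  intro h
  rw [inv_add_inv h1 h2', inv_add_inv h3' h4, div_eq_div_iff (mul_ne_zero h1 h2')
    (mul_ne_zero h3' h4)] at h
  have key : 2 * y * (s ^ 2 - d ^ 2) = 0 := by linear_combination h
  simp [h2, hy0, sub_eq_zero, hsd] at key

theorem stmt_5 {F : Type*} [Field F] [Fintype F] [DecidableEq F] {n : ℕ}
    (hn : 0 < n) (hF : Fintype.card F = 3 ^ n)
    (a b : F) (hab : a * b ≠ 0) :
    (Finset.univ.filter fun x : F =>
      (x + a + b) ^ (3 ^ n - 2) - (x + a) ^ (3 ^ n - 2)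
        - (x + b) ^ (3 ^ n - 2) + x ^ (3 ^ n - 2) = 0).card =
    if a ^ 2 = b ^ 2 then 3 else 1 := by
  have h3 : (3 : F) = 0 := by
    have h := FiniteField.cast_card_eq_zero F
    rw [hF, Nat.cast_pow] at h
    exact_mod_cast (pow_eq_zero_iff hn.ne').mp h
  have hcard : 2 < Fintype.card F := hF ▸ (Nat.le_self_pow hn.ne' 3)
  have ha : a ≠ 0 := left_ne_zero_of_mul hab
  have hsd : (a + b) ^ 2 ≠ (a - b) ^ 2 := fun h =>
    hab (by linear_combination h - a * b * h3)
  have hmem : ∀ x : F, (x + a + b) ^ (3 ^ n - 2) - (x + a) ^ (3 ^ n - 2)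
      - (x + b) ^ (3 ^ n - 2) + x ^ (3 ^ n - 2) = 0 ↔
      x - (a + b) = 0 ∨ ((x - (a + b)) ^ 2 = (a + b) ^ 2 ∧ a - b = 0) ∨
        ((x - (a + b)) ^ 2 = (a - b) ^ 2 ∧ a + b = 0) := by
    intro x
    rw [← inv_sub_add_inv_add_eq_iff h3 hsd, ← hF]
    simp only [FiniteField.pow_card_sub_two_eq_inv hcard]
    rw [show x - (a + b) - (a + b) = x + a + b by linear_combination -(a + b) * h3,
      show x - (a + b) + (a + b) = x by ring,
      show x - (a + b) - (a - b) = x + a by linear_combination -a * h3,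
      show x - (a + b) + (a - b) = x + b by linear_combination -b * h3,
      ← sub_eq_zero (b := (x + a)⁻¹ + _)]
    ring_nf
  simp only [hmem]
  split_ifs with h
  · have hne : a ≠ -a := fun h => ha (by linear_combination a * h3 - h)
    rw [Finset.card_eq_three]
    refine ⟨0, a, -a, ha.symm, (neg_ne_zero.mpr ha).symm, hne, ?_⟩
    ext x
    simp only [Finset.mem_filter, Finset.mem_univ, true_and, Finset.mem_insert,
      Finset.mem_singleton]
    rcases sq_eq_sq_iff_eq_or_eq_neg.mp h with rfl | rfl
    · have e : x - (a + a) = x + a := by linear_combination -a * h3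
      have e' : a + a = -a := by linear_combination a * h3
      rw [e, e', sub_self, sq_eq_sq_iff_eq_or_eq_neg]
      have h1 : x + a = -a ↔ x = a :=
        ⟨fun h => by linear_combination h - a * h3, fun h => by linear_combination h + a * h3⟩
      simp [h1, ha, add_eq_zero_iff_eq_neg]
      tauto
    · have e : -b - b = b := by linear_combination -b * h3
      have hb : b ≠ 0 := right_ne_zero_of_mul hab
      simp [e, hb, sq_eq_sq_iff_eq_or_eq_neg]
      tauto
  · have hd : a - b ≠ 0 := fun h' => h (by linear_combination (a + b) * h')
    have hs : a + b ≠ 0 := fun h' => h (by linear_combination (a - b) * h')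
    simp [hd, hs, sub_eq_zero, Finset.filter_eq']
end

section
/- Let p be an odd prime with p ∉ {29, 37}, F = GF(p^n), and let f = Inv ∘ (0,1): f(0) = 1, f(1) = 0, f(x) = x^(p^n - 2) otherwise. Then for all a, b ∈ F*, the equation f(x+a+b) - f(x+a) - f(x+b) + f(x) = 0 has at most 3 solutions x ∈ F. -/
/-- Inversion on a field with its values at `0` and `1` exchanged. -/
def swapInv {F : Type*} [Field F] [DecidableEq F] (x : F) : F :=
  if x = 0 then 1 else if x = 1 then 0 else x⁻¹

/-- The second-order difference of `swapInv` in directions `a`, `b` vanishes at `x`. -/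
def IsSol {F : Type*} [Field F] [DecidableEq F] (a b x : F) : Prop :=
  swapInv (x + a + b) - swapInv (x + a) - swapInv (x + b) + swapInv x = 0

theorem card_le_three {α : Type*} [DecidableEq α] (s : Finset α) (C P Q R : α → Prop)
    (hs : ∀ x ∈ s, C x ∨ P x ∨ Q x ∨ R x)
    (hC : ∀ x ∈ s, ∀ y ∈ s, C x → C y → x = y) (hP : ∀ x ∈ s, ∀ y ∈ s, P x → P y → x = y)
    (hQ : ∀ x ∈ s, ∀ y ∈ s, Q x → Q y → x = y) (hR : ∀ x ∈ s, ∀ y ∈ s, R x → R y → x = y)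
    (hn : ∀ x ∈ s, ∀ y ∈ s, ∀ z ∈ s, P x → Q y → R z → False) : s.card ≤ 3 := by
  classical
  have key : ∀ T : α → Prop, (∀ x ∈ s, ∀ y ∈ s, T x → T y → x = y) → (s.filter T).card ≤ 1 := by
    intro T hT
    rw [Finset.card_le_one]
    simp only [Finset.mem_filter]
    exact fun x hx y hy => hT x hx.1 y hy.1 hx.2 hy.2
  have hsub : s ⊆ s.filter C ∪ (s.filter P ∪ (s.filter Q ∪ s.filter R)) := by
    intro x hx
    simpa [hx] using hs x hx
  have hempty : s.filter P = ∅ ∨ s.filter Q = ∅ ∨ s.filter R = ∅ := by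
    by_contra! h
    obtain ⟨⟨x, hx⟩, ⟨y, hy⟩, z, hz⟩ := h
    simp only [Finset.mem_filter] at hx hy hz
    exact hn x hx.1 y hy.1 z hz.1 hx.2 hy.2 hz.2
  have h0 := Finset.card_le_card hsub
  have h1 := Finset.card_union_le (s.filter C) (s.filter P ∪ (s.filter Q ∪ s.filter R))
  have h2 := Finset.card_union_le (s.filter P) (s.filter Q ∪ s.filter R)
  have h3 := Finset.card_union_le (s.filter Q) (s.filter R)
  have := key C hC
  have := key P hP
  have := key Q hQ
  have := key R hR
  rcases hempty with h | h | h <;> rw [← Finset.card_eq_zero] at h <;> omega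

section

variable {F : Type*} [Field F] {a b : F}

theorem eq_one_of_two_zero_conditions (h2 : (2 : F) ≠ 0) (ha : a ≠ 0) (hb : b ≠ 0)
    (h : a * b * (a + b + 1) = (a + b) ^ 2)
    (h' : a * -b * (a + -b + 1) = (a + -b) ^ 2) : a = 1 := by
  grind

theorem eq_neg_two_of_two_one_conditions (h2 : (2 : F) ≠ 0) (hb : b ≠ 0)
    (h : a * b = (a + b + 1) ^ 2) (h' : a * -b = (a + -b + 1) ^ 2) :
    a = -2 ∧ b ^ 2 = -1 := by
  have : a = -2 := by grind
  subst this
  exact ⟨rfl, by grind⟩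

theorem not_opposite_zero_conditions (h2 : (2 : F) ≠ 0) (ha : a ≠ 0) (hb : b ≠ 0)
    (hs : a + b ≠ 0) (h : a * b * (a + b + 1) = (a + b) ^ 2)
    (h' : -a * -b * (-a + -b + 1) = (-a + -b) ^ 2) : False := by
  have : 2 * (a * b * (a + b)) = 0 := by linear_combination h - h'
  simp_all

theorem not_opposite_one_conditions (h2 : (2 : F) ≠ 0) (hs : a + b ≠ 0)
    (h : a * b = (a + b + 1) ^ 2) (h' : -a * -b = (-a + -b + 1) ^ 2) : False := by
  have : 2 * (2 * (a + b)) = 0 := by linear_combination h' - h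
  simp_all

theorem not_three_conditions (h29 : (29 : F) ≠ 0) (h37 : (37 : F) ≠ 0)
    (ha : a = -2) (hb : b ^ 2 = -1)
    (h0 : a * b * (a + b + 1) = (a + b) ^ 2 ∨ -a * -b * (-a + -b + 1) = (-a + -b) ^ 2) :
    False := by
  subst ha
  rcases h0 with h0 | h0
  · have : 6 * b = 1 := by linear_combination h0 + 3 * hb
    exact h37 (by linear_combination 36 * hb - (6 * b + 1) * this)
  · have : 2 * b = -5 := by linear_combination -h0 + hb
    exact h29 (by linear_combination 4 * hb - (2 * b - 5) * this)

end

section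

variable {F : Type*} [Field F] [DecidableEq F] {a b x : F}

theorem swapInv_zero : swapInv (0 : F) = 1 := by simp [swapInv]

theorem swapInv_one : swapInv (1 : F) = 0 := by simp [swapInv]

theorem swapInv_of_ne (h0 : x ≠ 0) (h1 : x ≠ 1) : swapInv x = x⁻¹ := by
  simp [swapInv, h0, h1]

theorem swapInv_cases (x : F) :
    (x = 0 ∧ swapInv x = 1) ∨ (x = 1 ∧ swapInv x = 0) ∨
      (x ≠ 0 ∧ x ≠ 1 ∧ swapInv x * x = 1) := by
  by_cases h0 : x = 0
  · exact .inl ⟨h0, h0 ▸ swapInv_zero⟩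
  by_cases h1 : x = 1
  · exact .inr (.inl ⟨h1, h1 ▸ swapInv_one⟩)
  · exact .inr (.inr ⟨h0, h1, by rw [swapInv_of_ne h0 h1, inv_mul_cancel₀ h0]⟩)

theorem IsSol.swap (h : IsSol a b x) : IsSol b a x := by
  unfold IsSol at *
  rw [show x + b + a = x + a + b by ring]
  linear_combination h

theorem IsSol.neg_left {c : F} (h : IsSol a b x) (e : x + a = c) : IsSol (-a) b c := by
  subst e
  unfold IsSol at *
  rw [show x + a + -a + b = x + b by ring, show x + a + -a = x by ring]
  linear_combination -h

theorem IsSol.neg_right {c : F} (h : IsSol a b x) (e : x + b = c) : IsSol a (-b) c :=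
  (h.swap.neg_left e).swap

theorem IsSol.neg_both {c : F} (h : IsSol a b x) (e : x + a + b = c) : IsSol (-a) (-b) c :=
  (h.neg_left rfl).neg_right e

theorem IsSol.cases (ha : a ≠ 0) (hb : b ≠ 0) (h : IsSol a b x) :
    2 * x + a + b = 0 ∨ (x = 0 ∨ x = -a ∨ x = -b ∨ x = -a - b) ∨
      (x = 1 ∨ x = 1 - a - b) ∨ (x = 1 - a ∨ x = 1 - b) := by
  by_contra! hx
  obtain ⟨hc, ⟨h1, h3, h4, h5⟩, ⟨h6, h7⟩, h8, h9⟩ := hx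
  unfold IsSol at h
  have k1 : x + a ≠ 0 := fun e => h3 (by linear_combination e)
  have k2 : x + b ≠ 0 := fun e => h4 (by linear_combination e)
  have k3 : x + a + b ≠ 0 := fun e => h5 (by linear_combination e)
  rw [swapInv_of_ne h1 h6, swapInv_of_ne k1 fun e => h8 (by linear_combination e),
    swapInv_of_ne k2 fun e => h9 (by linear_combination e),
    swapInv_of_ne k3 fun e => h7 (by linear_combination e)] at h
  field_simp at h
  have : (2 * x + a + b) * (a * b) = 0 := by linear_combination h
  simp_all

/-- The condition for the parallelogram with corner `0`, in general position. -/
theorem IsSol.at_zero (ha : a ≠ 0) (ha1 : a ≠ 1) (hb : b ≠ 0) (hb1 : b ≠ 1)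
    (hs : a + b ≠ 0) (hs1 : a + b ≠ 1) (h : IsSol a b 0) :
    a * b * (a + b + 1) = (a + b) ^ 2 := by
  unfold IsSol at h
  simp only [zero_add] at h
  rw [swapInv_zero, swapInv_of_ne ha ha1, swapInv_of_ne hb hb1, swapInv_of_ne hs hs1] at h
  field_simp at h
  linear_combination h

/-- The condition for the parallelogram with corner `1`, in general position. -/
theorem IsSol.at_one (ha : a ≠ 0) (ha1 : a ≠ -1) (hb : b ≠ 0) (hb1 : b ≠ -1)
    (hs : a + b ≠ 0) (hs1 : a + b ≠ -1) (h : IsSol a b 1) :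
    a * b = (a + b + 1) ^ 2 := by
  unfold IsSol at h
  have k1 : 1 + a ≠ 0 := fun e => ha1 (by linear_combination e)
  have k2 : 1 + b ≠ 0 := fun e => hb1 (by linear_combination e)
  have k3 : 1 + a + b ≠ 0 := fun e => hs1 (by linear_combination e)
  rw [swapInv_one, swapInv_of_ne k1 (by simpa using ha), swapInv_of_ne k2 (by simpa using hb),
    swapInv_of_ne k3 fun e => hs (by linear_combination e)] at h
  field_simp at h
  linear_combination h

theorem IsSol.one_at_zero (h2 : (2 : F) ≠ 0) (h3 : (3 : F) ≠ 0) (hb : b ≠ 0) (h : IsSol 1 b 0) :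
    b ^ 2 + b = 1 := by
  unfold IsSol at h
  have := swapInv_cases (0 + 1 + b)
  have := swapInv_cases (0 + 1 : F)
  have := swapInv_cases (0 + b)
  have := swapInv_cases (0 : F)
  grind

theorem IsSol.one_at_neg_one (h2 : (2 : F) ≠ 0) (h3 : (3 : F) ≠ 0) (hb : b ≠ 0)
    (h : IsSol 1 b (-1)) :
    2 * b ^ 2 - 2 * b + 1 = 0 := by
  unfold IsSol at h
  have := swapInv_cases (-1 + 1 + b)
  have := swapInv_cases (-1 + 1 : F)
  have := swapInv_cases (-1 + b)
  have := swapInv_cases (-1 : F)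
  grind

theorem IsSol.one_at_one (h2 : (2 : F) ≠ 0) (h3 : (3 : F) ≠ 0) (hb : b ≠ 0) (h : IsSol 1 b 1) :
    b ^ 2 + 3 * b + 4 = 0 := by
  unfold IsSol at h
  have := swapInv_cases (1 + 1 + b)
  have := swapInv_cases (1 + 1 : F)
  have := swapInv_cases (1 + b)
  have := swapInv_cases (1 : F)
  grind

theorem card_generic {s : Finset F} (hs : ∀ x ∈ s, IsSol a b x)
    (h2 : (2 : F) ≠ 0) (h29 : (29 : F) ≠ 0) (h37 : (37 : F) ≠ 0)
    (ha : a ≠ 0) (hb : b ≠ 0) (ha1 : a ≠ 1) (ha2 : a ≠ -1) (hb1 : b ≠ 1) (hb2 : b ≠ -1)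
    (hu : a + b ≠ 0) (hu1 : a + b ≠ 1) (hu2 : a + b ≠ -1)
    (hv : a - b ≠ 0) (hv1 : a - b ≠ 1) (hv2 : a - b ≠ -1) : s.card ≤ 3 := by
  have na := neg_ne_zero.2 ha
  have nb := neg_ne_zero.2 hb
  have na1 : -a ≠ 1 := fun e => ha2 (by linear_combination -e)
  have na2 : -a ≠ -1 := fun e => ha1 (by linear_combination -e)
  have nb1 : -b ≠ 1 := fun e => hb2 (by linear_combination -e)
  have nb2 : -b ≠ -1 := fun e => hb1 (by linear_combination -e)
  have nu : -a + -b ≠ 0 := fun e => hu (by linear_combination -e)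
  have nu1 : -a + -b ≠ 1 := fun e => hu2 (by linear_combination -e)
  have nu2 : -a + -b ≠ -1 := fun e => hu1 (by linear_combination -e)
  rw [sub_eq_add_neg] at hv hv1 hv2
  have nv : -a + b ≠ 0 := fun e => hv (by linear_combination -e)
  have nv1 : -a + b ≠ 1 := fun e => hv2 (by linear_combination -e)
  have nv2 : -a + b ≠ -1 := fun e => hv1 (by linear_combination -e)
  have z1 : IsSol a b 0 → a * b * (a + b + 1) = (a + b) ^ 2 :=
    fun h => h.at_zero ha ha1 hb hb1 hu hu1
  have z2 : IsSol a b (-a) → -a * b * (-a + b + 1) = (-a + b) ^ 2 := fun h =>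
    (h.neg_left (by ring)).at_zero na na1 hb hb1 nv nv1
  have z3 : IsSol a b (-b) → a * -b * (a + -b + 1) = (a + -b) ^ 2 := fun h =>
    (h.neg_right (by ring)).at_zero ha ha1 nb nb1 hv hv1
  have z4 : IsSol a b (-a - b) → -a * -b * (-a + -b + 1) = (-a + -b) ^ 2 := fun h =>
    (h.neg_both (by ring)).at_zero na na1 nb nb1 nu nu1
  have o1 : IsSol a b 1 → a * b = (a + b + 1) ^ 2 :=
    fun h => h.at_one ha ha2 hb hb2 hu hu2
  have o2 : IsSol a b (1 - a) → -a * b = (-a + b + 1) ^ 2 := fun h =>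
    (h.neg_left (by ring)).at_one na na2 hb hb2 nv nv2
  have o3 : IsSol a b (1 - b) → a * -b = (a + -b + 1) ^ 2 := fun h =>
    (h.neg_right (by ring)).at_one ha ha2 nb nb2 hv hv2
  have o4 : IsSol a b (1 - a - b) → -a * -b = (-a + -b + 1) ^ 2 := fun h =>
    (h.neg_both (by ring)).at_one na na2 nb nb2 nu nu2
  have n12 : IsSol a b 0 → ¬ IsSol a b (-a) := fun h h' =>
    hb1 <| eq_one_of_two_zero_conditions h2 hb ha (by linear_combination z1 h)
      (by linear_combination z2 h')
  have n13 : IsSol a b 0 → ¬ IsSol a b (-b) := fun h h' =>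
    ha1 <| eq_one_of_two_zero_conditions h2 ha hb (z1 h) (z3 h')
  have n14 : IsSol a b 0 → ¬ IsSol a b (-a - b) := fun h h' =>
    not_opposite_zero_conditions h2 ha hb hu (z1 h) (z4 h')
  have n23 : IsSol a b (-a) → ¬ IsSol a b (-b) := fun h h' =>
    not_opposite_zero_conditions h2 na hb nv
      (z2 h) (by linear_combination z3 h')
  have n24 : IsSol a b (-a) → ¬ IsSol a b (-a - b) := fun h h' =>
    ha2 <| neg_eq_iff_eq_neg.1 <| eq_one_of_two_zero_conditions h2 na hb (z2 h) (z4 h')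
  have n34 : IsSol a b (-b) → ¬ IsSol a b (-a - b) := fun h h' =>
    hb2 <| neg_eq_iff_eq_neg.1 <| eq_one_of_two_zero_conditions h2 nb ha
      (by linear_combination z3 h) (by linear_combination z4 h')
  have m14 : IsSol a b 1 → ¬ IsSol a b (1 - a - b) := fun h h' =>
    not_opposite_one_conditions h2 hu (o1 h) (o4 h')
  have m23 : IsSol a b (1 - a) → ¬ IsSol a b (1 - b) := fun h h' =>
    not_opposite_one_conditions h2 nv
      (o2 h) (by linear_combination o3 h')
  refine card_le_three s (fun x => 2 * x + a + b = 0)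
    (fun x => x = 0 ∨ x = -a ∨ x = -b ∨ x = -a - b) (fun x => x = 1 ∨ x = 1 - a - b)
    (fun x => x = 1 - a ∨ x = 1 - b) ?_ ?_ ?_ ?_ ?_ ?_
  · intro x hx
    exact (hs x hx).cases ha hb
  · intro x _ y _ hx hy
    exact mul_left_cancel₀ h2 (by linear_combination hx - hy)
  · intro x hx y hy
    have hx := hs x hx
    have hy := hs y hy
    rintro (rfl | rfl | rfl | rfl) (rfl | rfl | rfl | rfl) <;>
      first
      | rfl
      | exact (n12 ‹_› ‹_›).elim
      | exact (n13 ‹_› ‹_›).elim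
      | exact (n14 ‹_› ‹_›).elim
      | exact (n23 ‹_› ‹_›).elim
      | exact (n24 ‹_› ‹_›).elim
      | exact (n34 ‹_› ‹_›).elim
  · intro x hx y hy
    have hx := hs x hx
    have hy := hs y hy
    rintro (rfl | rfl) (rfl | rfl) <;> first | rfl | exact (m14 ‹_› ‹_›).elim
  · intro x hx y hy
    have hx := hs x hx
    have hy := hs y hy
    rintro (rfl | rfl) (rfl | rfl) <;> first | rfl | exact (m23 ‹_› ‹_›).elim
  · intro x hx y hy z hz hxP hyQ hzR
    have hx := hs x hx
    have hy := hs y hy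
    have hz := hs z hz
    have hzero : (a * b * (a + b + 1) = (a + b) ^ 2 ∨
        -a * -b * (-a + -b + 1) = (-a + -b) ^ 2) ∨
        (a * -b * (a + -b + 1) = (a + -b) ^ 2 ∨
        -a * b * (-a + b + 1) = (-a + b) ^ 2) := by
      rcases hxP with rfl | rfl | rfl | rfl
      · exact .inl (.inl (z1 hx))
      · exact .inr (.inr (z2 hx))
      · exact .inr (.inl (z3 hx))
      · exact .inl (.inr (z4 hx))
    rcases hyQ with rfl | rfl <;> rcases hzR with rfl | rfl
    · obtain ⟨h, h'⟩ := eq_neg_two_of_two_one_conditions h2 ha (a := b) (b := a)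
        (by linear_combination o1 hy) (by linear_combination o2 hz)
      refine hzero.elim (fun k => not_three_conditions h29 h37 h h' ?_)
        (fun k => not_three_conditions h29 h37 h (b := -a) (by linear_combination h') ?_)
      · exact k.imp (fun k => by linear_combination k) (fun k => by linear_combination k)
      · exact k.symm.imp (fun k => by linear_combination k) (fun k => by linear_combination k)
    · obtain ⟨h, h'⟩ := eq_neg_two_of_two_one_conditions h2 hb (o1 hy) (o3 hz)
      refine hzero.elim (fun k => not_three_conditions h29 h37 h h' k)
        (fun k => not_three_conditions h29 h37 h (b := -b) (by linear_combination h') ?_)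
      exact k.imp (fun k => by linear_combination k) (fun k => by linear_combination k)
    · obtain ⟨h, h'⟩ := eq_neg_two_of_two_one_conditions h2 nb (a := -a) (b := -b)
        (o4 hy) (by linear_combination o2 hz)
      refine hzero.elim (fun k => not_three_conditions h29 h37 h h' ?_)
        (fun k => not_three_conditions h29 h37 h (b := b) (by linear_combination h') ?_)
      · exact k.symm.imp (fun k => by linear_combination k) (fun k => by linear_combination k)
      · exact k.symm.imp (fun k => by linear_combination k) (fun k => by linear_combination k)
    · obtain ⟨h, h'⟩ := eq_neg_two_of_two_one_conditions h2 na (a := -b) (b := -a)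
        (by linear_combination o4 hy) (by linear_combination o3 hz)
      refine hzero.elim (fun k => not_three_conditions h29 h37 h h' ?_)
        (fun k => not_three_conditions h29 h37 h (b := a) (by linear_combination h') ?_)
      · exact k.symm.imp (fun k => by linear_combination k) (fun k => by linear_combination k)
      · exact k.imp (fun k => by linear_combination k) (fun k => by linear_combination k)

theorem card_diag {s : Finset F} (hs : ∀ x ∈ s, IsSol a (-a) x) (h2 : (2 : F) ≠ 0)
    (ha : a ≠ 0) (ha1 : a ≠ 1) (ha2 : a ≠ -1) : s.card ≤ 3 := by
  have e0 : ¬ IsSol a (-a) 0 := by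
    unfold IsSol
    have na1 : -a ≠ 1 := fun e => ha2 (by linear_combination -e)
    simp only [zero_add, add_neg_cancel]
    rw [swapInv_zero, swapInv_of_ne ha ha1, swapInv_of_ne (neg_ne_zero.2 ha) na1, inv_neg]
    intro h
    exact h2 (by linear_combination h)
  have e1 : ¬ IsSol a (-a) 1 := by
    unfold IsSol
    intro h
    have := swapInv_cases (1 + a)
    have := swapInv_cases (1 + -a)
    have := swapInv_one (F := F)
    rw [add_neg_cancel_right] at h
    grind
  have e1a : ∀ c : F, c ≠ 0 → c ≠ 1 → c ≠ -1 → IsSol c (-c) (1 + c) → 3 * c = -1 := by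
    unfold IsSol
    intro c h0 h1 h1' h
    have := swapInv_cases (1 + c)
    have := swapInv_cases (1 + c + c)
    have := swapInv_one (F := F)
    rw [add_neg_cancel_right, add_neg_cancel_right] at h
    grind
  refine card_le_three s (fun x => x = a) (fun x => x = -a) (fun x => x = 1 + a ∨ x = 1 - a)
    (fun _ => False) ?_ ?_ ?_ ?_ ?_ ?_
  · intro x hx
    have hx := hs x hx
    have hx0 : x ≠ 0 := fun e => e0 (e ▸ hx)
    have hx1 : x ≠ 1 := fun e => e1 (e ▸ hx)
    have := hx.cases ha (neg_ne_zero.2 ha)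
    clear e0 e1 e1a hs
    have hx2 : 2 * x ≠ 0 := mul_ne_zero h2 hx0
    grind
  · rintro x - y - rfl rfl
    rfl
  · rintro x - y - rfl rfl
    rfl
  · intro x hx y hy
    have hx := hs x hx
    have hy := hs y hy
    have k : IsSol a (-a) (1 - a) → 3 * -a = -1 := fun h =>
      e1a (-a) (neg_ne_zero.2 ha) (fun e => ha2 (by linear_combination -e))
        (fun e => ha1 (by linear_combination -e)) (by simpa [sub_eq_add_neg] using h.swap)
    have k' : IsSol a (-a) (1 - a) → ¬ IsSol a (-a) (1 + a) := fun h h' =>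
      h2 (by linear_combination k h + e1a a ha ha1 ha2 h')
    rintro (rfl | rfl) (rfl | rfl) <;> first | rfl | exact (k' ‹_› ‹_›).elim
  · tauto
  · tauto

theorem card_one {s : Finset F} (hs : ∀ x ∈ s, IsSol 1 b x) (h2 : (2 : F) ≠ 0)
    (h3 : (3 : F) ≠ 0) (hb : b ≠ 0) : s.card ≤ 3 := by
  have hn := neg_ne_zero.2 hb
  have p1 : IsSol 1 b 0 → b ^ 2 + b = 1 := IsSol.one_at_zero h2 h3 hb
  have p2 : IsSol 1 b (-b) → b ^ 2 - b = 1 := fun h => by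
    linear_combination IsSol.one_at_zero h2 h3 hn (h.neg_right (by ring))
  have q1 : IsSol 1 b (-1) → 2 * b ^ 2 - 2 * b + 1 = 0 := IsSol.one_at_neg_one h2 h3 hb
  have q2 : IsSol 1 b (-1 - b) → 2 * b ^ 2 + 2 * b + 1 = 0 := fun h => by
    linear_combination IsSol.one_at_neg_one h2 h3 hn (h.neg_right (by ring))
  have r1 : IsSol 1 b 1 → b ^ 2 + 3 * b + 4 = 0 := IsSol.one_at_one h2 h3 hb
  have r2 : IsSol 1 b (1 - b) → b ^ 2 - 3 * b + 4 = 0 := fun h => by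
    linear_combination IsSol.one_at_one h2 h3 hn (h.neg_right (by ring))
  have key : ∀ c : F, c ^ 2 + c = 1 → 2 * c ^ 2 - 2 * c + 1 = 0 ∨ 2 * c ^ 2 + 2 * c + 1 = 0 →
      c ^ 2 + 3 * c + 4 = 0 ∨ c ^ 2 - 3 * c + 4 = 0 → False := by
    rintro c hp (hq | hq) hr
    · have h4 : 4 * c = 3 := by linear_combination 2 * hp - hq
      have h5 : (5 : F) = 0 := by linear_combination 16 * hp - (4 * c + 7) * h4
      rcases hr with hr | hr
      · exact mul_ne_zero h2 h2 (by linear_combination 16 * hr - (4 * c + 15) * h4 - 21 * h5)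
      · exact h2 (by linear_combination 16 * hr - (4 * c - 9) * h4 - 7 * h5)
    · exact h3 (by linear_combination hq - 2 * hp)
  refine card_le_three s (fun x => 2 * x + 1 + b = 0) (fun x => x = 0 ∨ x = -b)
    (fun x => x = -1 ∨ x = -1 - b) (fun x => x = 1 ∨ x = 1 - b) ?_ ?_ ?_ ?_ ?_ ?_
  · intro x hx
    have := (hs x hx).cases one_ne_zero hb
    grind
  · intro x _ y _ hx hy
    exact mul_left_cancel₀ h2 (by linear_combination hx - hy)
  · intro x hx y hy
    have hx := hs x hx
    have hy := hs y hy
    have k : IsSol 1 b 0 → ¬ IsSol 1 b (-b) := fun h h' =>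
      mul_ne_zero h2 hb (by linear_combination p1 h - p2 h')
    rintro (rfl | rfl) (rfl | rfl) <;> first | rfl | exact (k ‹_› ‹_›).elim
  · intro x hx y hy
    have hx := hs x hx
    have hy := hs y hy
    have k : IsSol 1 b (-1) → ¬ IsSol 1 b (-1 - b) := fun h h' =>
      mul_ne_zero h2 (mul_ne_zero h2 hb) (by linear_combination q2 h' - q1 h)
    rintro (rfl | rfl) (rfl | rfl) <;> first | rfl | exact (k ‹_› ‹_›).elim
  · intro x hx y hy
    have hx := hs x hx
    have hy := hs y hy
    have k : IsSol 1 b 1 → ¬ IsSol 1 b (1 - b) := fun h h' =>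
      mul_ne_zero h2 (mul_ne_zero h3 hb) (by linear_combination r1 h - r2 h')
    rintro (rfl | rfl) (rfl | rfl) <;> first | rfl | exact (k ‹_› ‹_›).elim
  · intro x hx y hy z hz hxP hyQ hzR
    have hx := hs x hx
    have hy := hs y hy
    have hz := hs z hz
    have hQ : 2 * b ^ 2 - 2 * b + 1 = 0 ∨ 2 * b ^ 2 + 2 * b + 1 = 0 := by
      rcases hyQ with rfl | rfl
      exacts [.inl (q1 hy), .inr (q2 hy)]
    have hR : b ^ 2 + 3 * b + 4 = 0 ∨ b ^ 2 - 3 * b + 4 = 0 := by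
      rcases hzR with rfl | rfl
      exacts [.inl (r1 hz), .inr (r2 hz)]
    rcases hxP with rfl | rfl
    · exact key b (p1 hx) hQ hR
    · refine key (-b) (by linear_combination p2 hx)
        (hQ.symm.imp (fun h => ?_) fun h => ?_) (hR.symm.imp (fun h => ?_) fun h => ?_) <;>
        linear_combination h

theorem IsSol.one_of_char_three (h3 : (3 : F) = 0) (hb : b ≠ 0) (hb1 : b ≠ 1) (hb2 : b ≠ -1)
    (hx : x = 0 ∨ x = -1 ∨ x = 1) (h : IsSol 1 b x) : (x + b) * (x + b + 1) = 1 := by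
  unfold IsSol at h
  rcases hx with rfl | rfl | rfl
  · simp only [zero_add] at h
    have := swapInv_cases (1 + b)
    have := swapInv_cases b
    have := swapInv_zero (F := F)
    have := swapInv_one (F := F)
    grind
  · simp only [neg_add_cancel, zero_add] at h
    have := swapInv_cases (-1 + b)
    have := swapInv_cases b
    have := swapInv_zero (F := F)
    have := swapInv_cases (-1 : F)
    grind
  · have := swapInv_cases (1 + 1 + b)
    have := swapInv_cases (1 + b)
    have := swapInv_one (F := F)
    have := swapInv_cases (1 + 1 : F)
    grind

theorem card_one_char_three {s : Finset F} (hs : ∀ x ∈ s, IsSol 1 b x) (h3 : (3 : F) = 0)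
    (hb : b ≠ 0) : s.card ≤ 3 := by
  by_cases hb' : b = 1 ∨ b = -1
  · refine card_le_three s (fun x => x = 0) (fun x => x = 1) (fun x => x = -1)
      (fun _ => False) ?_ ?_ ?_ ?_ ?_ ?_
    · intro x hx
      have := (hs x hx).cases one_ne_zero hb
      clear hs hx
      rcases hb' with rfl | rfl <;> grind
    · rintro x - y - rfl rfl
      rfl
    · rintro x - y - rfl rfl
      rfl
    · rintro x - y - rfl rfl
      rfl
    · tauto
    · tauto
  have unique : ∀ c : F, c ≠ 0 → c ≠ 1 → c ≠ -1 → ∀ x y : F, (x = 0 ∨ x = -1 ∨ x = 1) →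
      (y = 0 ∨ y = -1 ∨ y = 1) → IsSol 1 c x → IsSol 1 c y → x = y := by
    intro c h0 h1 h1' x y hx hy h h'
    have k := IsSol.one_of_char_three h3 h0 h1 h1' hx h
    have k' := IsSol.one_of_char_three h3 h0 h1 h1' hy h'
    clear h h'
    rcases hx with rfl | rfl | rfl <;> rcases hy with rfl | rfl | rfl <;> grind
  have h2 : (2 : F) ≠ 0 := fun e => one_ne_zero (α := F) (by linear_combination h3 - e)
  push Not at hb'
  obtain ⟨hb1, hb2⟩ := hb'
  refine card_le_three s (fun x => 2 * x + 1 + b = 0) (fun x => x = 0 ∨ x = -1 ∨ x = 1)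
    (fun x => x = -b ∨ x = -1 - b ∨ x = 1 - b) (fun _ => False) ?_ ?_ ?_ ?_ ?_ ?_
  · intro x hx
    have := (hs x hx).cases one_ne_zero hb
    grind
  · intro x _ y _ hx hy
    exact mul_left_cancel₀ h2 (by linear_combination hx - hy)
  · intro x hx y hy hxP hyP
    exact unique b hb hb1 hb2 x y hxP hyP (hs x hx) (hs y hy)
  · intro x hx y hy hxQ hyQ
    have hx := (hs x hx).neg_right rfl
    have hy := (hs y hy).neg_right rfl
    refine add_right_cancel (unique (-b) (neg_ne_zero.2 hb) (fun e => hb2 ?_) (fun e => hb1 ?_)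
      (x + b) (y + b) (by grind) (by grind) hx hy) <;> linear_combination -e
  · tauto
  · tauto

theorem card_sum_one {s : Finset F} (hs : ∀ x ∈ s, IsSol a (1 - a) x) (h2 : (2 : F) ≠ 0)
    (ha0 : a ≠ 0) (ha1 : a ≠ 1) (ha2 : a ≠ -1) (ha3 : a ≠ 2) (hv : 2 * a ≠ 1) : s.card ≤ 3 := by
  have p1 : IsSol a (1 - a) 0 → a ^ 2 - a + 1 = 0 := by
    intro h
    unfold IsSol at h
    rw [zero_add, add_sub_cancel, zero_add] at h
    have := swapInv_cases a
    have := swapInv_cases (1 - a)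
    have := swapInv_zero (F := F)
    have := swapInv_one (F := F)
    grind
  have p2 : IsSol a (1 - a) 1 → a ^ 2 - a + 4 = 0 := by
    intro h
    unfold IsSol at h
    rw [show 1 + a + (1 - a) = 2 by ring] at h
    have := swapInv_cases (1 + a)
    have := swapInv_cases (1 + (1 - a))
    have := swapInv_cases (2 : F)
    have := swapInv_one (F := F)
    grind
  have p0 : ¬ IsSol a (1 - a) (-1) := by
    intro h
    unfold IsSol at h
    rw [show -1 + a + (1 - a) = 0 by ring] at h
    have := swapInv_cases (-1 + a)
    have := swapInv_cases (-1 + (1 - a))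
    have := swapInv_cases (-1 : F)
    have := swapInv_zero (F := F)
    grind
  have q : ∀ c : F, c ≠ 0 → c ≠ 1 → c ≠ -1 → c ≠ 2 → 2 * c ≠ 1 → IsSol c (1 - c) (-c) →
      (2 * c - 1) ^ 2 + 2 * c * (1 - c) ^ 2 = 0 := by
    intro c _ _ _ _ _ h
    unfold IsSol at h
    rw [neg_add_cancel, zero_add] at h
    have := swapInv_cases (1 - c)
    have := swapInv_cases (-c + (1 - c))
    have := swapInv_cases (-c)
    have := swapInv_zero (F := F)
    grind
  have r : ∀ c : F, c ≠ 0 → c ≠ 1 → c ≠ -1 → c ≠ 2 → 2 * c ≠ 1 → IsSol c (1 - c) c →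
      3 * c = -1 := by
    intro c _ _ _ _ _ h
    unfold IsSol at h
    rw [add_sub_cancel] at h
    have := swapInv_cases (c + c)
    have := swapInv_cases (c + c + (1 - c))
    have := swapInv_cases c
    have := swapInv_one (F := F)
    grind
  have k1 : 1 - a ≠ 0 := fun e => ha1 (by linear_combination -e)
  have k2 : 1 - a ≠ 1 := fun e => ha0 (by linear_combination -e)
  have k3 : 1 - a ≠ -1 := fun e => ha3 (by linear_combination -e)
  have k4 : 1 - a ≠ 2 := fun e => ha2 (by linear_combination -e)
  have k5 : 2 * (1 - a) ≠ 1 := fun e => hv (by linear_combination -e)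
  have q1 := q a ha0 ha1 ha2 ha3 hv
  have r1 := r a ha0 ha1 ha2 ha3 hv
  have q2 : IsSol a (1 - a) (a - 1) → (2 * a - 1) ^ 2 + 2 * (1 - a) * a ^ 2 = 0 := fun h => by
    linear_combination q (1 - a) k1 k2 k3 k4 k5 (by simpa using h.swap)
  have r2 : IsSol a (1 - a) (1 - a) → 3 * a = 4 := fun h => by
    linear_combination -r (1 - a) k1 k2 k3 k4 k5 (by simpa using h.swap)
  clear q r
  have key : ∀ c : F, c ^ 2 - c + 1 = 0 ∨ c ^ 2 - c + 4 = 0 →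
      (2 * c - 1) ^ 2 + 2 * c * (1 - c) ^ 2 = 0 ∨ (2 * c - 1) ^ 2 + 2 * (1 - c) * c ^ 2 = 0 →
      3 * c = 4 → False := by
    grind
  refine card_le_three s (fun x => 2 * x + a + (1 - a) = 0) (fun x => x = 0 ∨ x = 1)
    (fun x => x = -a ∨ x = a - 1) (fun x => x = a ∨ x = 1 - a) ?_ ?_ ?_ ?_ ?_ ?_
  · intro x hx
    have hx := hs x hx
    have h0 : x ≠ -1 := fun e => p0 (e ▸ hx)
    have := hx.cases ha0 k1
    clear hs hx p0 p1 p2 q1 q2 r1 r2 key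
    grind
  · intro x _ y _ hx hy
    exact mul_left_cancel₀ h2 (by linear_combination hx - hy)
  · intro x hx y hy
    have hx := hs x hx
    have hy := hs y hy
    have k : IsSol a (1 - a) 0 → ¬ IsSol a (1 - a) 1 := fun h h' => by
      have h3 : (3 : F) = 0 := by linear_combination p2 h' - p1 h
      exact ha2 (eq_neg_of_add_eq_zero_left
        (pow_eq_zero_iff two_ne_zero |>.1 (by linear_combination p1 h + a * h3)))
    rintro (rfl | rfl) (rfl | rfl) <;> first | rfl | exact (k ‹_› ‹_›).elim
  · intro x hx y hy
    have hx := hs x hx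
    have hy := hs y hy
    have k : IsSol a (1 - a) (-a) → ¬ IsSol a (1 - a) (a - 1) := fun h h' =>
      mul_ne_zero (mul_ne_zero h2 (mul_ne_zero ha0 k1)) (sub_ne_zero.2 hv)
        (by linear_combination q2 h' - q1 h)
    rintro (rfl | rfl) (rfl | rfl) <;> first | rfl | exact (k ‹_› ‹_›).elim
  · intro x hx y hy
    have hx := hs x hx
    have hy := hs y hy
    have k : IsSol a (1 - a) a → ¬ IsSol a (1 - a) (1 - a) := fun h h' => by
      have h5 : (5 : F) = 0 := by linear_combination r1 h - r2 h'
      exact hv (by linear_combination (a - 1) * h5 - r2 h')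
    rintro (rfl | rfl) (rfl | rfl) <;> first | rfl | exact (k ‹_› ‹_›).elim
  · intro x hx y hy z hz hxP hyQ hzR
    have hx := hs x hx
    have hy := hs y hy
    have hz := hs z hz
    have hP : a ^ 2 - a + 1 = 0 ∨ a ^ 2 - a + 4 = 0 := by
      rcases hxP with rfl | rfl
      exacts [.inl (p1 hx), .inr (p2 hx)]
    have hQ : (2 * a - 1) ^ 2 + 2 * a * (1 - a) ^ 2 = 0 ∨
        (2 * a - 1) ^ 2 + 2 * (1 - a) * a ^ 2 = 0 := by
      rcases hyQ with rfl | rfl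
      exacts [.inl (q1 hy), .inr (q2 hy)]
    rcases hzR with rfl | rfl
    · refine key (1 - z) (hP.imp (fun h => ?_) fun h => ?_)
        (hQ.symm.imp (fun h => ?_) fun h => ?_) ?_
      · linear_combination h
      · linear_combination h
      · linear_combination h
      · linear_combination h
      · linear_combination -r1 hz
    · exact key a hP hQ (r2 hz)

/-- In directions `a` and `b` there are at most three solutions. -/
def AtMostThree (a b : F) : Prop :=
  ∀ s : Finset F, (∀ x ∈ s, IsSol a b x) → s.card ≤ 3

theorem AtMostThree.swap (h : AtMostThree a b) : AtMostThree b a :=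
  fun s hs => h s fun x hx => (hs x hx).swap

theorem AtMostThree.of_neg_left (h : AtMostThree (-a) b) : AtMostThree a b := by
  intro s hs
  have := h (s.map (Equiv.addRight a).toEmbedding) (by
    simpa using fun x hx => (hs _ hx).neg_left (neg_add_cancel_right x a))
  simpa using this

theorem AtMostThree.of_neg_right (h : AtMostThree a (-b)) : AtMostThree a b :=
  (AtMostThree.of_neg_left h.swap).swap

theorem atMostThree_one (h2 : (2 : F) ≠ 0) (hb : b ≠ 0) : AtMostThree 1 b := by
  intro s hs
  by_cases h3 : (3 : F) = 0
  · exact card_one_char_three hs h3 hb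
  · exact card_one hs h2 h3 hb

theorem atMostThree_of_sq_eq_one (h2 : (2 : F) ≠ 0) (hb : b ≠ 0) (ha : a = 1 ∨ a = -1) :
    AtMostThree a b := by
  rcases ha with rfl | rfl
  · exact atMostThree_one h2 hb
  · exact .of_neg_left (by simpa using atMostThree_one h2 hb)

theorem atMostThree_of_add_eq_zero (h2 : (2 : F) ≠ 0) (ha : a ≠ 0) (ha1 : a ≠ 1)
    (ha2 : a ≠ -1) (h : a + b = 0) : AtMostThree a b := by
  obtain rfl : b = -a := by linear_combination h
  exact fun s hs => card_diag hs h2 ha ha1 ha2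

theorem atMostThree_of_add_eq_one (h2 : (2 : F) ≠ 0) (ha : a ≠ 0) (ha1 : a ≠ 1)
    (ha2 : a ≠ -1) (hb : b ≠ 0) (hb2 : b ≠ -1) (h : a + b = 1) : AtMostThree a b := by
  by_cases hv : a + -b = 0
  · exact .of_neg_right (atMostThree_of_add_eq_zero h2 ha ha1 ha2 hv)
  obtain rfl : b = 1 - a := by linear_combination h
  exact fun s hs => card_sum_one hs h2 ha ha1 ha2 (fun e => hb2 (by linear_combination -e))
    fun e => hv (by linear_combination e)

theorem atMostThree (h2 : (2 : F) ≠ 0) (h29 : (29 : F) ≠ 0) (h37 : (37 : F) ≠ 0)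
    (ha : a ≠ 0) (hb : b ≠ 0) : AtMostThree a b := by
  by_cases ha' : a = 1 ∨ a = -1
  · exact atMostThree_of_sq_eq_one h2 hb ha'
  by_cases hb' : b = 1 ∨ b = -1
  · exact (atMostThree_of_sq_eq_one h2 ha hb').swap
  push Not at ha' hb'
  obtain ⟨ha1, ha2⟩ := ha'
  obtain ⟨hb1, hb2⟩ := hb'
  have na := neg_ne_zero.2 ha
  have nb := neg_ne_zero.2 hb
  have na1 : -a ≠ 1 := fun e => ha2 (by linear_combination -e)
  have na2 : -a ≠ -1 := fun e => ha1 (by linear_combination -e)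
  have nb2 : -b ≠ -1 := fun e => hb1 (by linear_combination -e)
  by_cases hu : a + b = 0
  · exact atMostThree_of_add_eq_zero h2 ha ha1 ha2 hu
  by_cases hu1 : a + b = 1
  · exact atMostThree_of_add_eq_one h2 ha ha1 ha2 hb hb2 hu1
  by_cases hu2 : a + b = -1
  · exact .of_neg_left <| .of_neg_right <|
      atMostThree_of_add_eq_one h2 na na1 na2 nb nb2 (by linear_combination -hu2)
  by_cases hv : a - b = 0
  · exact .of_neg_right (atMostThree_of_add_eq_zero h2 ha ha1 ha2 (by linear_combination hv))
  by_cases hv1 : a - b = 1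
  · exact .of_neg_right
      (atMostThree_of_add_eq_one h2 ha ha1 ha2 nb nb2 (by linear_combination hv1))
  by_cases hv2 : a - b = -1
  · exact .of_neg_left
      (atMostThree_of_add_eq_one h2 na na1 na2 hb hb2 (by linear_combination -hv2))
  exact fun s hs =>
    card_generic hs h2 h29 h37 ha hb ha1 ha2 hb1 hb2 hu hu1 hu2 hv hv1 hv2

end

theorem stmt_11 {F : Type*} [Field F] [Fintype F] [DecidableEq F] {p n : ℕ}
    (hp : Nat.Prime p) (hodd : Odd p) (hp29 : p ≠ 29) (hp37 : p ≠ 37)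
    (hn : 0 < n) (hF : Fintype.card F = p ^ n)
    (f : F → F)
    (hf : f = fun x => if x = 0 then 1 else if x = 1 then 0 else x ^ (p ^ n - 2)) :
    ∀ a b : F, a ≠ 0 → b ≠ 0 →
      (Finset.univ.filter fun x : F =>
        f (x + a + b) - f (x + a) - f (x + b) + f x = 0).card ≤ 3 := by
  intro a b ha hb
  have : Fact p.Prime := ⟨hp⟩
  have hchar : CharP F p := charP_of_card_eq_prime_pow hF
  have hne : ∀ q : ℕ, q.Prime → p ≠ q → (q : F) ≠ 0 := fun q hq hpq h =>
    hpq ((Nat.prime_dvd_prime_iff_eq hp hq).1 ((CharP.cast_eq_zero_iff F p q).1 h))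
  have h2 : (2 : F) ≠ 0 := by
    exact_mod_cast hne 2 Nat.prime_two (by rintro rfl; exact absurd hodd (by decide))
  have h29 : (29 : F) ≠ 0 := by exact_mod_cast hne 29 (by norm_num) hp29
  have h37 : (37 : F) ≠ 0 := by exact_mod_cast hne 37 (by norm_num) hp37
  have hswap : f = swapInv := by
    subst hf
    funext x
    unfold swapInv
    split_ifs with h0 h1
    · rfl
    · rfl
    · have hq : 2 < p ^ n := by
        have h3 : 3 ≤ p := by
          have := hp.two_le
          rcases hodd with ⟨k, rfl⟩
          omega
        calc 2 < p := h3
          _ = p ^ 1 := (pow_one p).symm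
          _ ≤ p ^ n := Nat.pow_le_pow_right hp.pos hn
      refine eq_inv_of_mul_eq_one_left ?_
      rw [← pow_succ, show p ^ n - 2 + 1 = p ^ n - 1 by omega, ← hF,
        FiniteField.pow_card_sub_one_eq_one x h0]
  refine atMostThree h2 h29 h37 ha hb _ fun x hx => ?_
  rw [Finset.mem_filter, hswap] at hx
  exact hx.2
end
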